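/- A commutative unital κ-algebra generated by idempotents is von Neumann regular. -/

import Mathlib

/-- A partition of unity `e` diagonalizing multiplication by `a` over the field `κ`. -/
def HasEigenPartition (κ : Type*) {A : Type*} [Field κ] [CommRing A] [Algebra κ A] (a : A) :
    Prop :=
  ∃ (ι : Type) (_ : Fintype ι) (e : ι → A) (c : ι → κ),
    ∑ i, e i = 1 ∧ ∀ i, a * e i = algebraMap κ A (c i) * e i

namespace HasEigenPartition

variable {κ A : Type*} [Field κ] [CommRing A] [Algebra κ A] {a b : A}

theorem of_algebraMap (r : κ) : HasEigenPartition κ (algebraMap κ A r) :=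
  ⟨Unit, inferInstance, fun _ => 1, fun _ => r, by simp, fun _ => rfl⟩

theorem of_isIdempotentElem (ha : IsIdempotentElem a) : HasEigenPartition κ a := by
  refine ⟨Bool, inferInstance, fun i => cond i a (1 - a), fun i => cond i 1 0, by simp, ?_⟩
  rintro (_ | _)
  · simp [mul_sub, ha.eq]
  · simp [ha.eq]

theorem add (ha : HasEigenPartition κ a) (hb : HasEigenPartition κ b) :
    HasEigenPartition κ (a + b) := by
  obtain ⟨ι, _, e, c, he, hc⟩ := ha
  obtain ⟨ι', _, f, d, hf, hd⟩ := hb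
  refine ⟨ι × ι', inferInstance, fun p => e p.1 * f p.2, fun p => c p.1 + d p.2, ?_, fun p => ?_⟩
  · rw [Fintype.sum_prod_type, ← Fintype.sum_mul_sum, he, hf, one_mul]
  · rw [map_add]
    linear_combination f p.2 * hc p.1 + e p.1 * hd p.2

theorem mul (ha : HasEigenPartition κ a) (hb : HasEigenPartition κ b) :
    HasEigenPartition κ (a * b) := by
  obtain ⟨ι, _, e, c, he, hc⟩ := ha
  obtain ⟨ι', _, f, d, hf, hd⟩ := hb
  refine ⟨ι × ι', inferInstance, fun p => e p.1 * f p.2, fun p => c p.1 * d p.2, ?_, fun p => ?_⟩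
  · rw [Fintype.sum_prod_type, ← Fintype.sum_mul_sum, he, hf, one_mul]
  · rw [map_mul]
    linear_combination b * f p.2 * hc p.1 + algebraMap κ A (c p.1) * e p.1 * hd p.2

theorem exists_mul_mul_eq (ha : HasEigenPartition κ a) : ∃ x : A, a * x * a = a := by
  obtain ⟨ι, _, e, c, he, hc⟩ := ha
  refine ⟨∑ i, algebraMap κ A (c i)⁻¹ * e i, ?_⟩
  calc a * (∑ i, algebraMap κ A (c i)⁻¹ * e i) * a = ∑ i, a * e i := by
        rw [Finset.mul_sum, Finset.sum_mul]
        refine Finset.sum_congr rfl fun i _ => ?_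
        have h : algebraMap κ A (c i) * algebraMap κ A (c i)⁻¹ * algebraMap κ A (c i) =
            algebraMap κ A (c i) := by
          rw [← map_mul, ← map_mul, mul_inv_mul_cancel]
        linear_combination (algebraMap κ A (c i)⁻¹ * (a + algebraMap κ A (c i)) - 1) * hc i +
          e i * h
    _ = a := by rw [← Finset.mul_sum, he, mul_one]

end HasEigenPartition

/-- A commutative unital `κ`-algebra generated by idempotents is von Neumann regular. -/
theorem stmt_1 {κ A : Type} [Field κ] [CommRing A] [Algebra κ A]
    (hA : Algebra.adjoin κ {e : A | IsIdempotentElem e} = ⊤) :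
    ∀ a : A, ∃ x : A, a * x * a = a := by
  intro a
  have ha : a ∈ Algebra.adjoin κ {e : A | IsIdempotentElem e} := hA ▸ Algebra.mem_top
  refine HasEigenPartition.exists_mul_mul_eq (κ := κ) ?_
  induction ha using Algebra.adjoin_induction with
  | mem x hx => exact .of_isIdempotentElem hx
  | algebraMap r => exact .of_algebraMap r
  | add x y _ _ hx hy => exact hx.add hy
  | mul x y _ _ hx hy => exact hx.mul hy
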